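/- Let ϖ₀ > 0, E > 0, b > 0, G ≥ 0 and 1 ≤ λ < 2 be real numbers, and let x : [0, ∞) → [0, ∞) be differentiable with x'(t) ≤ 2ϖ₀(−x(t)²/E + b·x(t)^{1+λ/2} + G·x(t)^{1/2}) for all t ≥ 0. Then limsup_{t→∞} x(t) ≤ max((2bE)^{2/(2−λ)}, (2GE)^{2/3}). -/

import Mathlib

open Filter

/-- If a nonnegative function on `[0, ∞)` decreases at a uniform rate whenever it is at least `a`,
then it is eventually at most `a`. -/
theorem eventually_le_of_deriv_le_neg {x : ℝ → ℝ} {a δ : ℝ} (hδ : 0 < δ)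
    (hx0 : ∀ t : ℝ, 0 ≤ t → 0 ≤ x t) (hdiff : ∀ t : ℝ, 0 ≤ t → DifferentiableAt ℝ x t)
    (hderiv : ∀ t : ℝ, 0 ≤ t → a ≤ x t → deriv x t ≤ -δ) :
    ∀ᶠ t in atTop, x t ≤ a := by
  obtain ⟨t₀, ht₀, hxt₀⟩ : ∃ t₀ : ℝ, 0 ≤ t₀ ∧ x t₀ ≤ a := by
    by_contra! h
    have hT : 0 ≤ (x 0 + 1) / δ := div_nonneg (by linarith [hx0 0 le_rfl]) hδ.le
    have key := (convex_Ici (0 : ℝ)).image_sub_le_mul_sub_of_deriv_le (f := x) (C := -δ)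
      (fun t ht => (hdiff t ht).continuousAt.continuousWithinAt)
      (fun t ht => (hdiff t (interior_subset ht)).differentiableWithinAt)
      (fun t ht => hderiv t (interior_subset ht) (h t (interior_subset ht)).le)
      0 Set.self_mem_Ici _ hT hT
    have hmul : -δ * ((x 0 + 1) / δ - 0) = -(x 0 + 1) := by field_simp; ring
    linarith [hx0 _ hT]
  filter_upwards [eventually_ge_atTop t₀] with t ht
  refine image_le_of_deriv_right_lt_deriv_boundary (f := x) (f' := deriv x) (a := t₀) (b := t)
    (B := fun _ => a) (B' := fun _ => 0)
    (fun s hs => (hdiff s (ht₀.trans hs.1)).continuousAt.continuousWithinAt)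
    (fun s hs => (hdiff s (ht₀.trans hs.1)).hasDerivAt.hasDerivWithinAt)
    hxt₀ (fun s => hasDerivAt_const s a) (fun s hs hsa => ?_) ⟨ht, le_rfl⟩
  linarith [hderiv s (ht₀.trans hs.1) hsa.ge]

/-- A power `k * y ^ q` with `q < 2` is at most `y ^ 2` once `y ≥ k ^ (1 / (2 - q))`, with a uniform
gap away from that threshold. -/
theorem exists_pos_add_mul_rpow_le_sq {k q a : ℝ} (hk : 0 ≤ k) (hq0 : 0 ≤ q) (hq : q < 2)
    (ha : k ^ (1 / (2 - q)) < a) :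
    ∃ c > 0, ∀ y, a ≤ y → c + k * y ^ q ≤ y ^ 2 := by
  have hq' : 0 < 2 - q := by linarith
  have ha0 : 0 < a := (Real.rpow_nonneg hk _).trans_lt ha
  have hka : k < a ^ (2 - q) := by
    have h := Real.rpow_lt_rpow (Real.rpow_nonneg hk _) ha hq'
    rwa [← Real.rpow_mul hk, one_div_mul_cancel hq'.ne', Real.rpow_one] at h
  refine ⟨a ^ q * (a ^ (2 - q) - k), mul_pos (Real.rpow_pos_of_pos ha0 _) (sub_pos.2 hka),
    fun y hy => ?_⟩
  have hy0 : 0 < y := ha0.trans_le hy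
  have hsq : y ^ 2 = y ^ q * y ^ (2 - q) := by
    rw [← Real.rpow_add hy0, add_sub_cancel, Real.rpow_two]
  have hmul : a ^ q * (a ^ (2 - q) - k) ≤ y ^ q * (y ^ (2 - q) - k) :=
    mul_le_mul (Real.rpow_le_rpow ha0.le hy hq0)
      (sub_le_sub_right (Real.rpow_le_rpow ha0.le hy hq'.le) k)
      (sub_nonneg.2 hka.le) (Real.rpow_nonneg hy0.le _)
  rw [hsq]
  linarith

/-- Proposition 2 (absorbing ball for the global enstrophy `D₁` in regime I): if
`x' ≤ 2ϖ₀(−x²/E + b x^{1+λ/2} + G x^{1/2})` on `[0,∞)` with `x ≥ 0` and `1 ≤ λ < 2`, then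
`limsup_{t→∞} x(t) ≤ max((2bE)^{2/(2-λ)}, (2GE)^{2/3})`. -/
theorem stmt_11 (ϖ₀ E b G lam : ℝ) (hϖ₀ : 0 < ϖ₀) (hE : 0 < E) (hb : 0 < b) (hG : 0 ≤ G)
    (hlam1 : 1 ≤ lam) (hlam2 : lam < 2)
    (x : ℝ → ℝ) (hx0 : ∀ t : ℝ, 0 ≤ t → 0 ≤ x t)
    (hdiff : ∀ t : ℝ, 0 ≤ t → DifferentiableAt ℝ x t)
    (hineq : ∀ t : ℝ, 0 ≤ t →
      deriv x t ≤ 2 * ϖ₀ * (-(x t) ^ 2 / E + b * x t ^ (1 + lam / 2) + G * x t ^ ((1 : ℝ)/2))) :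
    limsup x atTop ≤ max ((2 * b * E) ^ ((2 : ℝ) / (2 - lam))) ((2 * G * E) ^ ((2 : ℝ) / 3)) := by
  have hcobdd : IsCoboundedUnder (· ≤ ·) atTop x :=
    IsBoundedUnder.isCoboundedUnder_le
      ⟨0, eventually_map.2 ((eventually_ge_atTop 0).mono fun t ht => hx0 t ht)⟩
  refine le_of_forall_gt_imp_ge_of_dense fun a ha => limsup_le_of_le hcobdd ?_
  obtain ⟨hab, haG⟩ := max_lt_iff.1 ha
  have hexpb : (2 : ℝ) / (2 - lam) = 1 / (2 - (1 + lam / 2)) := by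
    have h₁ : 2 - lam ≠ 0 := by linarith
    have h₂ : 2 - (1 + lam / 2) ≠ 0 := by linarith
    rw [div_eq_div_iff h₁ h₂]
    ring
  have hexpG : (2 : ℝ) / 3 = 1 / (2 - 1 / 2) := by norm_num
  rw [hexpb] at hab
  rw [hexpG] at haG
  obtain ⟨c, hc, hcb⟩ := exists_pos_add_mul_rpow_le_sq (by positivity) (by linarith)
    (by linarith) hab
  obtain ⟨d, hd, hdG⟩ := exists_pos_add_mul_rpow_le_sq (by positivity) (by norm_num)
    (by norm_num) haG
  refine eventually_le_of_deriv_le_neg (δ := 2 * ϖ₀ * ((c + d) / (2 * E))) (by positivity)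
    hx0 hdiff fun t ht hat => (hineq t ht).trans ?_
  rw [← mul_neg]
  refine mul_le_mul_of_nonneg_left ?_ (by positivity)
  have hsum := add_le_add (hcb _ hat) (hdG _ hat)
  have hrw : -(x t) ^ 2 / E + b * x t ^ (1 + lam / 2) + G * x t ^ ((1 : ℝ) / 2) =
      (-(2 * x t ^ 2) + 2 * b * E * x t ^ (1 + lam / 2) + 2 * G * E * x t ^ ((1 : ℝ) / 2)) /
        (2 * E) := by
    field_simp
  rw [hrw, ← neg_div]
  exact div_le_div_of_nonneg_right (by linarith) (by positivity)
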